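/- Let W be a 1-regular graphon on a standard Borel probability space (J,𝓑,π) and η_W = W·(π×π) the induced Markov space, whose kernel is P_x = W(x,·)·π. Then for every finite tree F=(V,E), the tree measure satisfies η_W^F = W^F·π^V. Consequently σ^F ≪ π^{L(F)}, i.e., every finite tree is loose in η_W; equivalently, η_W is k-loose for every integer k≥1. -/

import Mathlib

open MeasureTheory ProbabilityTheory Filter
open scoped ENNReal

attribute [local instance] Classical.propDecidable

variable {J : Type*} [MeasurableSpace J]

/-- The sequential construction of the law of a random homomorphism of a rooted tree on
`Fin n` (with parent map `par`, where `par i < i` for `i ≠ 0`) into a Markov space with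
stationary distribution `π` and step kernel `P`: vertex `0` is drawn from `π` and each
subsequent vertex `i` is obtained by a Markov step of `P` from the image of `par i`. -/
noncomputable def treeMeasure (π : Measure J) (P : Kernel J J) :
    (n : ℕ) → (Fin n → Fin n) → Measure (Fin n → J)
  | 0, _ => Measure.dirac fun i : Fin 0 => i.elim0
  | (n + 1), par =>
      ((treeMeasure π P n fun i => ⟨(par i.castSucc).1 % n, Nat.mod_lt _ i.pos⟩).compProd
        (if h : 0 < n then
          Kernel.comap P
            (fun x : Fin n → J => x ⟨(par (Fin.last n)).1 % n, Nat.mod_lt _ h⟩)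
            (measurable_pi_apply _)
        else Kernel.const _ π)).map
        fun q => Fin.snoc q.1 q.2

/-- `(e, par)` is a *search order* of the graph `G`: an enumeration `e : Fin n ≃ V` of the
vertices such that every vertex other than the first one is adjacent to exactly one earlier
vertex, namely its parent `par`. -/
def IsSearchOrder {V : Type*} (G : SimpleGraph V) {n : ℕ} (e : Fin n ≃ V)
    (par : Fin n → Fin n) : Prop :=
  (∀ i : Fin n, 0 < i.1 → (par i).1 < i.1) ∧
  (∀ i : Fin n, 0 < i.1 → G.Adj (e (par i)) (e i)) ∧
  (∀ i j : Fin n, j.1 < i.1 → G.Adj (e j) (e i) → j = par i)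

/-- The law `η^F` on `J^V` of the random homomorphism of a tree on `V` enumerated by the
search order `(e, par)`. -/
noncomputable def treeLaw {V : Type*} (π : Measure J) (P : Kernel J J)
    {n : ℕ} (e : Fin n ≃ V) (par : Fin n → Fin n) : Measure (V → J) :=
  (treeMeasure π P n par).map fun x v => x (e.symm v)

/-- The set of leaves of a graph: vertices with exactly one neighbour. -/
def leafSet {V : Type*} (G : SimpleGraph V) : Set V := {v | ∃! w, G.Adj v w}

/-- The marginal `σ^F` of the tree law on the leaves of the tree. -/
noncomputable def leafMarginal {V : Type*} (π : Measure J) (P : Kernel J J)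
    (G : SimpleGraph V) {n : ℕ} (e : Fin n ≃ V) (par : Fin n → Fin n) :
    Measure (↥(leafSet G) → J) :=
  (treeLaw π P e par).map fun x (v : ↥(leafSet G)) => x v.1

/-- The tree `G` is *loose* in the Markov space with stationary distribution `π` and kernel
`P`: the marginal of `η^G` on the set of leaves is absolutely continuous with respect to
`π^{L(G)}` (for any, equivalently every, search order). -/
def TreeLoose {V : Type*} [Fintype V] (π : Measure J) (P : Kernel J J)
    (G : SimpleGraph V) : Prop :=
  ∀ (n : ℕ) (e : Fin n ≃ V) (par : Fin n → Fin n), IsSearchOrder G e par →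
    leafMarginal π P G e par ≪ Measure.pi fun _ : ↥(leafSet G) => π

/-- The Markov kernel `P_x = W(x, ·) ⬝ π` of the Markov space induced by a `1`-regular
graphon `W`. -/
noncomputable def graphonKernel (π : Measure J) [SFinite π] (W : J → J → ℝ≥0∞) : Kernel J J :=
  Kernel.withDensity (Kernel.const J π) W

/-- A density of an s-finite kernel gives an s-finite kernel, also when it takes the value `∞`. -/
theorem isSFiniteKernel_withDensity_of_measurable {α β : Type*} [MeasurableSpace α]
    [MeasurableSpace β] (κ : Kernel α β) [IsSFiniteKernel κ] {f : α → β → ℝ≥0∞}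
    (hf : Measurable (Function.uncurry f)) : IsSFiniteKernel (Kernel.withDensity κ f) := by
  let g : α → β → ℝ≥0∞ := fun a b => if f a b = ∞ then 0 else f a b
  let c : ℕ → α → β → ℝ≥0∞ := fun _ a b => if f a b = ∞ then 1 else 0
  have htop : MeasurableSet {p : α × β | f p.1 p.2 = ∞} := hf (measurableSet_singleton ∞)
  have hg : Measurable (Function.uncurry g) := Measurable.ite htop measurable_const hf
  have hc (n : ℕ) : Measurable (Function.uncurry (c n)) :=
    Measurable.ite htop measurable_const measurable_const
  have hsum : Measurable (Function.uncurry (∑' n, c n)) := by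
    have : Function.uncurry (∑' n, c n) = fun p => ∑' n, Function.uncurry (c n) p := by
      ext p
      change (∑' n, c n) p.1 p.2 = _
      rw [tsum_apply, tsum_apply]
      · rfl
      · exact Pi.summable.2 fun _ => ENNReal.summable
      · exact Pi.summable.2 fun _ => Pi.summable.2 fun _ => ENNReal.summable
    rw [this]
    exact Measurable.tsum hc
  have hdecomp : f = g + ∑' n, c n := by
    ext a b
    have h : (∑' n, c n) a b = ∑' n, c n a b := by
      rw [tsum_apply, tsum_apply]
      · exact Pi.summable.2 fun _ => ENNReal.summable
      · exact Pi.summable.2 fun _ => Pi.summable.2 fun _ => ENNReal.summable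
    rw [Pi.add_apply, Pi.add_apply, h]
    by_cases hab : f a b = ∞
    · simp [g, c, hab]
    · simp [g, c, hab]
  have hgfin : IsSFiniteKernel (Kernel.withDensity κ g) :=
    Kernel.IsSFiniteKernel.withDensity κ fun a b => by
      by_cases hab : f a b = ∞ <;> simp [g, hab]
  have hcfin (n : ℕ) : IsSFiniteKernel (Kernel.withDensity κ (c n)) :=
    Kernel.IsSFiniteKernel.withDensity κ fun a b => by
      by_cases hab : f a b = ∞ <;> simp [c, hab]
  rw [hdecomp, Kernel.withDensity_add_right hg hsum, Kernel.withDensity_tsum κ hc]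
  have := Kernel.isSFiniteKernel_sum (hκs := hcfin)
  exact @Kernel.IsSFiniteKernel.add _ _ _ _ _ _ hgfin this

/-- Precomposing with an injection of finite index sets preserves power measures. -/
theorem measurePreserving_pi_comp_injective {ι κ : Type*} [Fintype ι] [Fintype κ]
    (π : Measure J) [IsProbabilityMeasure π] {f : ι → κ} (hf : Function.Injective f) :
    MeasurePreserving (fun (x : κ → J) i => x (f i)) (Measure.pi fun _ : κ => π)
      (Measure.pi fun _ : ι => π) := by
  refine ⟨by fun_prop, ?_⟩
  have h : iIndepFun (fun (k : κ) (x : κ → J) => x k) (Measure.pi fun _ : κ => π) :=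
    iIndepFun_pi (X := fun _ x => x) fun _ => aemeasurable_id
  rw [(iIndepFun_iff_map_fun_eq_pi_map fun i => (measurable_pi_apply (f i)).aemeasurable).1
    (h.precomp hf)]
  congr 1
  ext1 i
  exact (measurePreserving_eval (fun _ : κ => π) (f i)).map_eq

/-- Absolute continuity passes to finite product measures. -/
theorem absolutelyContinuous_pi_fin :
    ∀ {n : ℕ} (μ ν : Fin n → Measure J) [∀ i, SigmaFinite (μ i)] [∀ i, SigmaFinite (ν i)],
      (∀ i, μ i ≪ ν i) → Measure.pi μ ≪ Measure.pi ν
  | 0, μ, ν, _, _, _ => by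
    rw [Subsingleton.elim μ ν]
  | n + 1, μ, ν, _, _, h => by
    have hμ := (measurePreserving_piFinSuccAbove μ 0).symm
    have hν := (measurePreserving_piFinSuccAbove ν 0).symm
    rw [← hμ.map_eq, ← hν.map_eq]
    exact ((h 0).prod (absolutelyContinuous_pi_fin _ _ fun j => h _)).map
      (MeasurableEquiv.measurable _)

/-- A uniform point of `J ^ (n + 1)` is obtained by appending an independent point. -/
theorem lintegral_pi_fin_snoc (π : Measure J) [IsProbabilityMeasure π] {n : ℕ}
    {f : (Fin (n + 1) → J) → ℝ≥0∞} (hf : Measurable f) :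
    ∫⁻ x, f x ∂(Measure.pi fun _ : Fin (n + 1) => π)
      = ∫⁻ x, ∫⁻ y, f (Fin.snoc x y) ∂π ∂(Measure.pi fun _ : Fin n => π) := by
  have h := (measurePreserving_piFinSuccAbove (fun _ : Fin (n + 1) => π) (Fin.last n)).symm
  have hm := h.measurable
  have hfm := hf.comp hm
  simp only [Function.comp_def] at hfm
  rw [← h.lintegral_comp hf, lintegral_prod_symm' _ hfm]
  simp [MeasurableEquiv.piFinSuccAbove, Fin.snocEquiv]

theorem measurable_snoc {n : ℕ} :
    Measurable fun q : (Fin n → J) × J => (Fin.snoc q.1 q.2 : Fin (n + 1) → J) := by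
  refine measurable_pi_lambda _ fun i => ?_
  induction i using Fin.lastCases with
  | last => simpa using measurable_snd
  | cast i => simpa [Function.comp_def] using (measurable_pi_apply i).comp measurable_fst

theorem measurable_prod_graphon {V : Type*} {n : ℕ} {W : J → J → ℝ≥0∞}
    (hW : Measurable (Function.uncurry W)) (e : Fin n → V) (par : Fin n → Fin n) :
    Measurable fun x : V → J =>
      ∏ i : Fin n, if 0 < i.1 then W (x (e i)) (x (e (par i))) else 1 := by
  refine Finset.measurable_prod _ fun i _ => ?_
  split_ifs
  · have h : Measurable fun x : V → J => (x (e i), x (e (par i))) := by fun_prop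
    exact hW.comp h
  · exact measurable_const

/-- The tree measure of a graphon kernel has density the product of the graphon over the
edges joining a vertex to its parent. -/
theorem treeMeasure_graphonKernel (π : Measure J) [IsProbabilityMeasure π]
    {W : J → J → ℝ≥0∞} (hW : Measurable (Function.uncurry W)) (hsym : ∀ x y, W x y = W y x) :
    ∀ (n : ℕ) (par : Fin n → Fin n), (∀ i : Fin n, 0 < i.1 → (par i).1 < i.1) →
      treeMeasure π (graphonKernel π W) n par
        = (Measure.pi fun _ : Fin n => π).withDensity
            (fun x => ∏ i : Fin n, if 0 < i.1 then W (x i) (x (par i)) else 1)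
  | 0, par, _ => by
    simp only [treeMeasure, Finset.univ_eq_empty, Finset.prod_empty]
    rw [show (fun _ : Fin 0 → J => (1 : ℝ≥0∞)) = 1 from rfl, withDensity_one]
    exact (Measure.pi_of_empty (fun _ : Fin 0 => π) _).symm
  | n + 1, par, hpar => by
    have hS : IsSFiniteKernel (graphonKernel π W) :=
      isSFiniteKernel_withDensity_of_measurable _ hW
    have hlt (i : Fin n) (hi : 0 < i.1) : (par i.castSucc).1 < n :=
      (hpar i.castSucc hi).trans i.2
    have ih := treeMeasure_graphonKernel π hW hsym n
      (fun i => ⟨(par i.castSucc).1 % n, Nat.mod_lt _ i.pos⟩) fun i hi => by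
        simpa [Nat.mod_eq_of_lt (hlt i hi)] using hpar i.castSucc hi
    have hD := measurable_prod_graphon hW id par
    have hDn := measurable_prod_graphon hW id
      (fun i : Fin n => ⟨(par i.castSucc).1 % n, Nat.mod_lt _ i.pos⟩)
    simp only [id] at hD hDn
    have hcast (x : Fin n → J) (y : J) (i : Fin n) :
        (if 0 < i.castSucc.1 then
            W ((Fin.snoc x y : Fin (n + 1) → J) i.castSucc)
              ((Fin.snoc x y : Fin (n + 1) → J) (par i.castSucc))
          else 1)
        = if 0 < i.1 then W (x i) (x ⟨(par i.castSucc).1 % n, Nat.mod_lt _ i.pos⟩) else 1 := by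
      by_cases hi : 0 < i.1
      · have hp : par i.castSucc
            = Fin.castSucc ⟨(par i.castSucc).1 % n, Nat.mod_lt _ i.pos⟩ := by
          ext
          simp [Nat.mod_eq_of_lt (hlt i hi)]
        rw [if_pos hi, if_pos (by simpa using hi), Fin.snoc_castSucc]
        conv_lhs => rw [hp, Fin.snoc_castSucc]
      · rw [if_neg hi, if_neg (by simpa using hi)]
    refine Measure.ext_of_lintegral _ fun f hf => ?_
    rw [lintegral_withDensity_eq_lintegral_mul _ hD hf, lintegral_pi_fin_snoc π (hD.mul hf),
      treeMeasure, ih, lintegral_map hf measurable_snoc]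
    simp only [Pi.mul_apply, Fin.prod_univ_castSucc, hcast]
    have hfs : Measurable fun q : (Fin n → J) × J => f (Fin.snoc q.1 q.2) :=
      hf.comp measurable_snoc
    by_cases hn : 0 < n
    · simp only [hn, dif_pos]
      rw [Measure.lintegral_compProd hfs, lintegral_withDensity_eq_lintegral_mul _ hDn
        (Measurable.lintegral_kernel_prod_right' hfs)]
      refine lintegral_congr fun x => ?_
      have hp : par (Fin.last n)
          = Fin.castSucc ⟨(par (Fin.last n)).1 % n, Nat.mod_lt _ hn⟩ := by
        ext
        exact (Nat.mod_eq_of_lt (hpar (Fin.last n) hn)).symm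
      have hfx : Measurable fun y : J => f (Fin.snoc x y) :=
        hfs.comp measurable_prodMk_left
      have hWx (z : J) : Measurable fun y : J => W z y := hW.comp measurable_prodMk_left
      rw [Pi.mul_apply, Kernel.comap_apply, graphonKernel,
        Kernel.lintegral_withDensity _ hW _ hfx, Kernel.const_apply,
        ← lintegral_const_mul _ (by exact (hWx _).mul hfx)]
      refine lintegral_congr fun y => ?_
      rw [if_pos (by simpa using hn), Fin.snoc_last]
      conv_rhs => rw [hp, Fin.snoc_castSucc, hsym, mul_assoc]
    · simp only [hn, dif_neg, not_false_eq_true]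
      rw [Measure.lintegral_compProd hfs, lintegral_withDensity_eq_lintegral_mul _ hDn
        (Measurable.lintegral_kernel_prod_right' hfs)]
      refine lintegral_congr fun x => ?_
      have hfx : Measurable fun y : J => f (Fin.snoc x y) :=
        hfs.comp measurable_prodMk_left
      rw [Pi.mul_apply, Kernel.const_apply, ← lintegral_const_mul _ hfx]
      simp [hn]

/-- The tree law of a graphon kernel has density the product of the graphon over the edges. -/
theorem treeLaw_graphonKernel {V : Type*} [Fintype V] (π : Measure J) [IsProbabilityMeasure π]
    {W : J → J → ℝ≥0∞} (hW : Measurable (Function.uncurry W)) (hsym : ∀ x y, W x y = W y x)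
    {n : ℕ} (e : Fin n ≃ V) (par : Fin n → Fin n)
    (hpar : ∀ i : Fin n, 0 < i.1 → (par i).1 < i.1) :
    treeLaw π (graphonKernel π W) e par
      = (Measure.pi fun _ : V => π).withDensity
          (fun x => ∏ i : Fin n, if 0 < i.1 then W (x (e i)) (x (e (par i))) else 1) := by
  have hmp := measurePreserving_pi_comp_injective π e.symm.injective
  have hD := measurable_prod_graphon hW e par
  have hDn := measurable_prod_graphon hW id par
  simp only [id] at hDn
  refine Measure.ext_of_lintegral _ fun f hf => ?_
  rw [treeLaw, treeMeasure_graphonKernel π hW hsym n par hpar, lintegral_map hf hmp.measurable,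
    lintegral_withDensity_eq_lintegral_mul _ hDn (by exact hf.comp hmp.measurable),
    lintegral_withDensity_eq_lintegral_mul _ hD hf, ← hmp.lintegral_comp (hD.mul hf)]
  simp

/-- Finitely many independent steps of a graphon kernel from a common random starting point
have an absolutely continuous joint law. -/
theorem bind_pi_graphonKernel_absolutelyContinuous (π : Measure J) [IsProbabilityMeasure π]
    {W : J → J → ℝ≥0∞} (hW : Measurable (Function.uncurry W))
    (hreg : ∀ᵐ x ∂π, ∫⁻ y, W x y ∂π = 1) (k : ℕ) :
    (π.bind fun x => Measure.pi fun _ : Fin k => graphonKernel π W x)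
      ≪ Measure.pi fun _ : Fin k => π := by
  by_cases hm : AEMeasurable (fun x => Measure.pi fun _ : Fin k => graphonKernel π W x) π
  · refine Measure.AbsolutelyContinuous.mk fun s hs h0 => ?_
    rw [Measure.bind_apply hs hm,
      lintegral_eq_zero_iff' (by exact (Measure.measurable_coe hs).comp_aemeasurable hm)]
    filter_upwards [hreg] with x hx
    have hPx : graphonKernel π W x = π.withDensity (W x) := by
      rw [graphonKernel, Kernel.withDensity_apply _ hW, Kernel.const_apply]
    have : IsFiniteMeasure (graphonKernel π W x) := by
      rw [hPx]
      exact isFiniteMeasure_withDensity (by simp [hx])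
    refine absolutelyContinuous_pi_fin _ _ (fun _ => ?_) h0
    rw [hPx]
    exact withDensity_absolutelyContinuous _ _
  · rw [Measure.bind, Measure.map_of_not_aemeasurable hm, Measure.join_zero]
    exact Measure.AbsolutelyContinuous.zero _

/-- **Theorem (tree measures of graphon Markov spaces, and looseness).**
Let `W` be a `1`-regular graphon on a probability space `(J, π)`, inducing the Markov space
`η_W = W ⬝ (π × π)` with kernel `P_x = W(x,·) ⬝ π`.  Then for every finite tree `F = (V, E)`
(enumerated by any search order `(e, par)`), the tree law satisfies `η_W^F = W^F ⬝ π^V`,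
where `W^F(x) = ∏_{uv ∈ E} W(x_u, x_v)` is written as the product over the non-root vertices
of `W(x_i, x_{par i})`.  Consequently every finite tree is loose in `η_W`; equivalently,
`η_W` is `k`-loose for every `k ≥ 1`. -/
theorem graphon_treeLaw_and_loose (π : Measure J) [IsProbabilityMeasure π]
    (W : J → J → ℝ≥0∞) (hWmeas : Measurable (Function.uncurry W))
    (hWsym : ∀ x y, W x y = W y x)
    (hWreg : ∀ᵐ x ∂π, ∫⁻ y, W x y ∂π = 1) :
    (∀ (V : Type) (_ : Fintype V) (_ : DecidableEq V) (G : SimpleGraph V), G.IsTree →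
      ∀ (n : ℕ) (e : Fin n ≃ V) (par : Fin n → Fin n), IsSearchOrder G e par →
        treeLaw π (graphonKernel π W) e par
          = (Measure.pi fun _ : V => π).withDensity
              (fun x => ∏ i : Fin n, if 0 < i.1 then W (x (e i)) (x (e (par i))) else 1)) ∧
    (∀ (V : Type) (_ : Fintype V) (_ : DecidableEq V) (G : SimpleGraph V), G.IsTree →
      TreeLoose π (graphonKernel π W) G) ∧
    (∀ k : ℕ, 1 ≤ k →
      (π.bind fun x => Measure.pi fun _ : Fin k => graphonKernel π W x)
        ≪ Measure.pi fun _ : Fin k => π) := by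
  refine ⟨fun V _ _ G _ n e par h => treeLaw_graphonKernel π hWmeas hWsym e par h.1,
    fun V _ _ G _ n e par h => ?_,
    fun k _ => bind_pi_graphonKernel_absolutelyContinuous π hWmeas hWreg k⟩
  have hmp := measurePreserving_pi_comp_injective (ι := ↥(leafSet G)) π Subtype.val_injective
  rw [leafMarginal, treeLaw_graphonKernel π hWmeas hWsym e par h.1, ← hmp.map_eq]
  exact (withDensity_absolutelyContinuous _ _).map hmp.measurable
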